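/- Let a, s > 0 with s < a+1. Then for all non-negative integers m, Σ_{n≥0} k^{-a}(n) k^s(n+m) = sin(πs)·Γ(1-s+a)·Γ(s+m) / (π·Γ(m+a+1)). In particular the sum is ≥ 0 for all m if and only if s lies in ∪_{j≥0}(2j, 2j+1] ∪ ℕ, and it vanishes for all m if and only if s is a positive integer. -/

import Mathlib

open Real

/-- Cesàro numbers: `ces c j` is the `j`-th Taylor coefficient of `(1-t)^{-c}`. -/
noncomputable def ces (c : ℝ) (j : ℕ) : ℝ :=
  (ascPochhammer ℝ j).eval c / (Nat.factorial j)

open Filter Topology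

/-- The shift relation `(x)_{n+1} = x (x+1)_n` for rising factorials. -/
lemma ascPochhammer_eval_succ_left (x : ℝ) (n : ℕ) :
    (ascPochhammer ℝ (n + 1)).eval x = x * (ascPochhammer ℝ n).eval (x + 1) := by
  simp [ascPochhammer_succ_left, Polynomial.eval_comp]

lemma ascPochhammer_eval_add (x : ℝ) (m n : ℕ) :
    (ascPochhammer ℝ (n + m)).eval x =
      (ascPochhammer ℝ m).eval x * (ascPochhammer ℝ n).eval (x + m) := by
  rw [add_comm n m, ← ascPochhammer_mul]
  simp [Polynomial.eval_comp]

lemma ascPochhammer_eval_eq_prod (x : ℝ) (n : ℕ) :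
    (ascPochhammer ℝ n).eval x = ∏ j ∈ Finset.range n, (x + j) := by
  induction n with
  | zero => simp
  | succ n ih => rw [ascPochhammer_succ_eval, ih, Finset.prod_range_succ]

lemma ascPochhammer_eval_mono {x y : ℝ} (hx : 0 ≤ x) (hxy : x ≤ y) (n : ℕ) :
    (ascPochhammer ℝ n).eval x ≤ (ascPochhammer ℝ n).eval y := by
  simp only [ascPochhammer_eval_eq_prod]
  exact Finset.prod_le_prod (fun j _ => by positivity) fun j _ => by gcongr

lemma ascPochhammer_eval_mul_Gamma {x : ℝ} (hx : 0 < x) (n : ℕ) :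
    (ascPochhammer ℝ n).eval x * Gamma x = Gamma (x + n) := by
  induction n with
  | zero => simp
  | succ n ih =>
    rw [ascPochhammer_succ_eval, mul_right_comm, ih, Nat.cast_succ, ← add_assoc,
      Gamma_add_one (by positivity), mul_comm]

/-- Euler's limit formula for the reciprocal of the Gamma function, valid at the poles too. -/
lemma tendsto_ascPochhammer_div_inv_Gamma (x : ℝ) :
    Tendsto (fun n : ℕ => (ascPochhammer ℝ (n + 1)).eval x / ((n : ℝ) ^ x * n.factorial))
      atTop (𝓝 (Gamma x)⁻¹) := by
  have hseq : (fun n : ℕ => (ascPochhammer ℝ (n + 1)).eval x / ((n : ℝ) ^ x * n.factorial)) =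
      fun n => (GammaSeq x n)⁻¹ := by
    ext n
    rw [GammaSeq, inv_div, ascPochhammer_eval_eq_prod]
  by_cases hx : Gamma x = 0
  · obtain ⟨m, rfl⟩ := (Gamma_eq_zero_iff x).1 hx
    rw [hx, inv_zero]
    refine tendsto_const_nhds.congr' ?_
    filter_upwards [eventually_ge_atTop m] with n hn
    rw [ascPochhammer_eval_neg_coe_nat_of_lt (by omega), zero_div]
  · rw [hseq]
    exact (GammaSeq_tendsto_Gamma x).inv₀ hx

/-- The `n`-th term of the hypergeometric series `₂F₁(α, β; γ; 1)`. -/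
noncomputable def gaussTerm (α β γ : ℝ) (n : ℕ) : ℝ :=
  (ascPochhammer ℝ n).eval α * (ascPochhammer ℝ n).eval β /
    ((ascPochhammer ℝ n).eval γ * n.factorial)

section Gauss

variable {α β γ : ℝ}

lemma gaussTerm_succ_mul (hγ : 0 < γ) {n : ℕ} (hn : 0 < n) :
    gaussTerm α β γ (n + 1) * (n + 1) =
      (ascPochhammer ℝ (n + 1)).eval α / ((n : ℝ) ^ α * n.factorial) *
      ((ascPochhammer ℝ (n + 1)).eval β / ((n : ℝ) ^ β * n.factorial)) /
      ((ascPochhammer ℝ (n + 1)).eval γ / ((n : ℝ) ^ γ * n.factorial)) *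
      (n : ℝ) ^ (-(γ - α - β)) := by
  have hn' : (0 : ℝ) < n := by exact_mod_cast hn
  have hp := (ascPochhammer_pos (n + 1) γ hγ).ne'
  have hf : (n.factorial : ℝ) ≠ 0 := by positivity
  have h1 := (rpow_pos_of_pos hn' α).ne'
  have h2 := (rpow_pos_of_pos hn' β).ne'
  have h3 := (rpow_pos_of_pos hn' γ).ne'
  rw [show -(γ - α - β) = α + β - γ by ring, rpow_sub hn', rpow_add hn', gaussTerm,
    Nat.factorial_succ]
  push_cast
  field_simp

lemma gaussTerm_succ_mul_isBigO (hγ : 0 < γ) :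
    (fun n : ℕ => gaussTerm α β γ (n + 1) * (n + 1)) =O[atTop]
      fun n : ℕ => (n : ℝ) ^ (-(γ - α - β)) := by
  have hlim := ((tendsto_ascPochhammer_div_inv_Gamma α).mul
    (tendsto_ascPochhammer_div_inv_Gamma β)).div (tendsto_ascPochhammer_div_inv_Gamma γ)
    (inv_ne_zero (Gamma_pos_of_pos hγ).ne')
  have hO := (hlim.isBigO_one ℝ).mul
    (Asymptotics.isBigO_refl (fun n : ℕ => (n : ℝ) ^ (-(γ - α - β))) atTop)
  refine hO.congr' ?_ (by simp)
  filter_upwards [eventually_gt_atTop 0] with n hn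
  exact (gaussTerm_succ_mul hγ hn).symm

lemma summable_gaussTerm (hγ : 0 < γ) (h : 0 < γ - α - β) : Summable (gaussTerm α β γ) := by
  rw [← summable_nat_add_iff 1]
  refine summable_of_isBigO_nat
    (summable_nat_rpow.2 (show -(γ - α - β) + -1 < -1 by linarith)) ?_
  have hinv : (fun n : ℕ => ((n : ℝ) + 1)⁻¹) =O[atTop] fun n : ℕ => (n : ℝ) ^ (-1 : ℝ) := by
    refine Asymptotics.IsBigO.of_bound 1 ?_
    filter_upwards [eventually_gt_atTop 0] with n hn
    have hn' : (0 : ℝ) < n := by exact_mod_cast hn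
    rw [rpow_neg_one, one_mul, norm_of_nonneg (by positivity), norm_of_nonneg (by positivity)]
    gcongr
    linarith
  refine ((gaussTerm_succ_mul_isBigO (α := α) (β := β) hγ).mul hinv).congr' ?_ ?_
  · refine Eventually.of_forall fun n => ?_
    have : (n : ℝ) + 1 ≠ 0 := by positivity
    simp [this]
  · filter_upwards [eventually_gt_atTop 0] with n hn
    rw [rpow_add (by exact_mod_cast hn)]

lemma tendsto_mul_gaussTerm (hγ : 0 < γ) (h : 0 < γ - α - β) :
    Tendsto (fun n : ℕ => (n : ℝ) * gaussTerm α β γ n) atTop (𝓝 0) := by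
  rw [← tendsto_add_atTop_iff_nat 1]
  have := (gaussTerm_succ_mul_isBigO (α := α) (β := β) hγ).trans_tendsto
    ((tendsto_rpow_neg_atTop h).comp tendsto_natCast_atTop_atTop)
  refine this.congr fun n => ?_
  push_cast
  ring

lemma gaussTerm_contiguous (hγ : 0 < γ) (n : ℕ) :
    γ * (γ - α - β) * gaussTerm α β γ n - (γ - α) * (γ - β) * gaussTerm α β (γ + 1) n =
      γ * (n * gaussTerm α β γ n) - γ * ((n + 1 : ℕ) * gaussTerm α β γ (n + 1)) := by
  have hp := (ascPochhammer_pos n γ hγ).ne'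
  have hf : (n.factorial : ℝ) ≠ 0 := by positivity
  have hn : γ + n ≠ 0 := by positivity
  have hshift : (ascPochhammer ℝ n).eval (γ + 1) =
      (ascPochhammer ℝ n).eval γ * (γ + n) / γ := by
    rw [eq_div_iff hγ.ne', ← ascPochhammer_succ_eval, ascPochhammer_eval_succ_left, mul_comm]
  simp only [gaussTerm, hshift, ascPochhammer_succ_eval, Nat.factorial_succ]
  push_cast
  field_simp
  ring

lemma tsum_gaussTerm_contiguous (hγ : 0 < γ) (h : 0 < γ - α - β) :
    γ * (γ - α - β) * ∑' n, gaussTerm α β γ n =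
      (γ - α) * (γ - β) * ∑' n, gaussTerm α β (γ + 1) n := by
  have h1 := (summable_gaussTerm hγ h).hasSum.mul_left (γ * (γ - α - β))
  have h2 := (summable_gaussTerm (α := α) (β := β) (γ := γ + 1) (by linarith)
    (by linarith)).hasSum.mul_left ((γ - α) * (γ - β))
  have h3 := (h1.sub h2).tendsto_sum_nat
  have h4 : Tendsto (fun N : ℕ => ∑ n ∈ Finset.range N,
      (γ * (γ - α - β) * gaussTerm α β γ n - (γ - α) * (γ - β) * gaussTerm α β (γ + 1) n))
      atTop (𝓝 0) := by
    simp only [gaussTerm_contiguous hγ]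
    simp only [Finset.sum_range_sub' (fun n : ℕ => γ * (n * gaussTerm α β γ n))]
    simpa using ((tendsto_mul_gaussTerm hγ h).const_mul γ).neg
  exact sub_eq_zero.1 (tendsto_nhds_unique h3 h4)

lemma tsum_gaussTerm_add_nat (hγ : 0 < γ) (h : 0 < γ - α - β) (N : ℕ) :
    (ascPochhammer ℝ N).eval γ * (ascPochhammer ℝ N).eval (γ - α - β) *
        ∑' n, gaussTerm α β γ n =
      (ascPochhammer ℝ N).eval (γ - α) * (ascPochhammer ℝ N).eval (γ - β) *
        ∑' n, gaussTerm α β (γ + N) n := by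
  induction N with
  | zero => simp
  | succ N ih =>
    have hstep := tsum_gaussTerm_contiguous (α := α) (β := β) (γ := γ + N) (by positivity)
      (by linarith [N.cast_nonneg (α := ℝ)])
    simp only [ascPochhammer_succ_eval]
    push_cast
    rw [← add_assoc]
    linear_combination (γ + N) * (γ - α - β + N) * ih +
      (ascPochhammer ℝ N).eval (γ - α) * (ascPochhammer ℝ N).eval (γ - β) * hstep

lemma abs_gaussTerm_add_le (hγ : 0 < γ) (N n : ℕ) :
    |gaussTerm α β (γ + N) n| ≤ |gaussTerm α β γ n| := by
  have hp := ascPochhammer_pos n γ hγ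
  have hle := ascPochhammer_eval_mono hγ.le (show γ ≤ γ + N by simp) n
  have hp' := hp.trans_le hle
  rw [gaussTerm, gaussTerm, abs_div, abs_div, abs_of_pos (mul_pos hp (by positivity)),
    abs_of_pos (mul_pos hp' (by positivity))]
  gcongr

lemma tendsto_gaussTerm_add (n : ℕ) :
    Tendsto (fun N : ℕ => gaussTerm α β (γ + N) n) atTop (𝓝 (if n = 0 then 1 else 0)) := by
  rcases Nat.eq_zero_or_pos n with rfl | hn
  · simp [gaussTerm]
  · rw [if_neg hn.ne']
    have hpoly : Tendsto (fun x => (ascPochhammer ℝ n).eval x) atTop atTop := by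
      refine Polynomial.tendsto_atTop_of_leadingCoeff_nonneg _ ?_ ?_
      · rw [← Polynomial.natDegree_pos_iff_degree_pos, ascPochhammer_natDegree]
        exact hn
      · rw [(monic_ascPochhammer ℝ n).leadingCoeff]
        exact zero_le_one
    exact ((hpoly.comp (tendsto_atTop_add_const_left _ γ
      tendsto_natCast_atTop_atTop)).atTop_mul_const (by positivity)).const_div_atTop _

lemma tendsto_tsum_gaussTerm_add (hγ : 0 < γ) (h : 0 < γ - α - β) :
    Tendsto (fun N : ℕ => ∑' n, gaussTerm α β (γ + N) n) atTop (𝓝 1) := by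
  have := tendsto_tsum_of_dominated_convergence (summable_gaussTerm hγ h).abs
    (tendsto_gaussTerm_add (α := α) (β := β) (γ := γ))
    (Eventually.of_forall fun N n => abs_gaussTerm_add_le hγ N n)
  rwa [tsum_ite_eq] at this

/-- Gauss's summation formula for `₂F₁(α, β; γ; 1)`. -/
theorem hasSum_gaussTerm (hγ : 0 < γ) (h : 0 < γ - α - β) :
    HasSum (gaussTerm α β γ)
      (Gamma γ * Gamma (γ - α - β) * (Gamma (γ - α))⁻¹ * (Gamma (γ - β))⁻¹) := by
  have hΓ := (Gamma_pos_of_pos hγ).ne'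
  have hΓ' := (Gamma_pos_of_pos h).ne'
  have hsum := (summable_gaussTerm hγ h).hasSum
  have hl := ((tendsto_ascPochhammer_div_inv_Gamma γ).mul
    (tendsto_ascPochhammer_div_inv_Gamma (γ - α - β))).mul_const (∑' n, gaussTerm α β γ n)
  have hr := ((tendsto_ascPochhammer_div_inv_Gamma (γ - α)).mul
    (tendsto_ascPochhammer_div_inv_Gamma (γ - β))).mul
    ((tendsto_add_atTop_iff_nat 1).2 (tendsto_tsum_gaussTerm_add hγ h))
  have heq := tendsto_nhds_unique_of_eventuallyEq hl hr (by
    filter_upwards [eventually_gt_atTop 0] with N hN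
    have hN' : (0 : ℝ) < N := by exact_mod_cast hN
    have hpow : (N : ℝ) ^ γ * (N : ℝ) ^ (γ - α - β) =
        (N : ℝ) ^ (γ - α) * (N : ℝ) ^ (γ - β) := by
      rw [← rpow_add hN', ← rpow_add hN']
      ring_nf
    rw [div_mul_div_comm, div_mul_div_comm, div_mul_eq_mul_div, div_mul_eq_mul_div,
      tsum_gaussTerm_add_nat hγ h, mul_mul_mul_comm, hpow,
      mul_mul_mul_comm _ (N.factorial : ℝ)])
  convert hsum using 1
  rw [mul_one] at heq
  rw [mul_assoc, ← heq]
  field_simp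

end Gauss

lemma ces_mul_ces_add (a s : ℝ) (m n : ℕ) :
    ces (-a) n * ces s (n + m) = ces s m * gaussTerm (-a) (s + m) (m + 1) n := by
  have hfac : ((n + m).factorial : ℝ) = m.factorial * (ascPochhammer ℝ n).eval ((m : ℝ) + 1) := by
    have := ascPochhammer_eval_add 1 m n
    rwa [ascPochhammer_eval_one, ascPochhammer_eval_one, add_comm (1 : ℝ)] at this
  have hp := (ascPochhammer_pos n ((m : ℝ) + 1) (by positivity)).ne'
  have hm : (m.factorial : ℝ) ≠ 0 := by positivity
  have hn : (n.factorial : ℝ) ≠ 0 := by positivity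
  rw [ces, ces, ces, gaussTerm, ascPochhammer_eval_add, hfac]
  field_simp

lemma inv_Gamma_one_sub {s : ℝ} (hs : 0 < s) :
    (Gamma (1 - s))⁻¹ = Gamma s * sin (π * s) / π := by
  have hΓ := (Gamma_pos_of_pos hs).ne'
  rw [eq_div_of_mul_eq hΓ ((mul_comm _ _).trans (Gamma_mul_Gamma_one_sub s))]
  simp only [inv_div, div_div_eq_mul_div]

theorem hasSum_ces_mul_ces_add {a s : ℝ} (hs : 0 < s) (hsa : s < a + 1) (m : ℕ) :
    HasSum (fun n : ℕ => ces (-a) n * ces s (n + m))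
      (sin (π * s) * Gamma (1 - s + a) * Gamma (s + m) / (π * Gamma ((m : ℝ) + a + 1))) := by
  simp only [ces_mul_ces_add]
  have hG := (hasSum_gaussTerm (α := -a) (β := s + m) (γ := (m : ℝ) + 1) (by positivity)
    (by linarith)).mul_left (ces s m)
  convert! hG using 1
  rw [show (m : ℝ) + 1 - -a - (s + m) = 1 - s + a by ring,
    show (m : ℝ) + 1 - -a = m + a + 1 by ring, show (m : ℝ) + 1 - (s + m) = 1 - s by ring,
    inv_Gamma_one_sub hs, Gamma_nat_eq_factorial, ces, ← ascPochhammer_eval_mul_Gamma hs]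
  field_simp

lemma sin_pi_mul_eq_zero_iff {s : ℝ} (hs : 0 < s) :
    sin (π * s) = 0 ↔ ∃ n : ℕ, 0 < n ∧ s = n := by
  rw [sin_eq_zero_iff]
  constructor
  · rintro ⟨k, hk⟩
    have hks : (k : ℝ) = s := mul_right_cancel₀ pi_ne_zero (hk.trans (mul_comm _ _))
    have hk0 : 0 < k := by rw [← hks] at hs; exact_mod_cast hs
    lift k to ℕ using hk0.le
    exact ⟨k, by exact_mod_cast hk0, by exact_mod_cast hks.symm⟩
  · rintro ⟨n, -, rfl⟩
    exact ⟨n, by push_cast; ring⟩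

lemma sin_pi_mul_nonneg_iff {s : ℝ} (hs : 0 < s) :
    0 ≤ sin (π * s) ↔
      ((s ∈ ⋃ j : ℕ, Set.Ioc (2 * (j : ℝ)) (2 * (j : ℝ) + 1)) ∨ ∃ n : ℕ, s = n) := by
  have hshift (j : ℕ) : sin (π * s) = sin (π * (s - 2 * j)) := by
    rw [← sin_sub_nat_mul_two_pi (π * s) j]
    ring_nf
  constructor
  · intro h
    by_cases hint : ∃ n : ℕ, s = n
    · exact Or.inr hint
    refine Or.inl (Set.mem_iUnion.2 ⟨⌊s / 2⌋₊, ?_⟩)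
    have h1 := Nat.floor_le (show 0 ≤ s / 2 by positivity)
    have h2 := Nat.lt_floor_add_one (s / 2)
    have h3 : s ≠ 2 * (⌊s / 2⌋₊ : ℝ) := fun h => hint ⟨2 * ⌊s / 2⌋₊, by exact_mod_cast h⟩
    refine ⟨lt_of_le_of_ne (by linarith) h3.symm, ?_⟩
    by_contra! hlt
    rw [hshift ⌊s / 2⌋₊, ← neg_neg (sin _), ← sin_sub_pi] at h
    have : 0 < sin (π * (s - 2 * (⌊s / 2⌋₊ : ℝ)) - π) :=
      sin_pos_of_pos_of_lt_pi (by nlinarith [pi_pos]) (by nlinarith [pi_pos])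
    linarith
  · rintro (h | ⟨n, rfl⟩)
    · obtain ⟨j, hj1, hj2⟩ := Set.mem_iUnion.1 h
      rw [hshift j]
      exact sin_nonneg_of_nonneg_of_le_pi (by nlinarith [pi_pos]) (by nlinarith [pi_pos])
    · rw [mul_comm, sin_nat_mul_pi]

/-- For `a, s > 0` with `s < a + 1`:
`Σ_n k^{-a}(n) k^s(n+m) = sin(πs)Γ(1-s+a)Γ(s+m)/(πΓ(m+a+1))` for all `m`; the sum is
non-negative for all `m` iff `s ∈ ∪_j (2j, 2j+1] ∪ ℕ`, and vanishes for all `m` iff `s`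
is a positive integer. -/
theorem stmt_17 (a s : ℝ) (ha : 0 < a) (hs : 0 < s) (hsa : s < a + 1) :
    (∀ m : ℕ, HasSum (fun n : ℕ => ces (-a) n * ces s (n + m))
      (Real.sin (π * s) * Real.Gamma (1 - s + a) * Real.Gamma (s + m) /
        (π * Real.Gamma ((m : ℝ) + a + 1)))) ∧
    ((∀ m : ℕ, 0 ≤ ∑' n : ℕ, ces (-a) n * ces s (n + m)) ↔
      ((s ∈ ⋃ j : ℕ, Set.Ioc (2 * (j : ℝ)) (2 * (j : ℝ) + 1)) ∨ ∃ n : ℕ, s = n)) ∧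
    ((∀ m : ℕ, ∑' n : ℕ, ces (-a) n * ces s (n + m) = 0) ↔
      ∃ n : ℕ, 0 < n ∧ s = n) := by
  have hsum := hasSum_ces_mul_ces_add hs hsa
  have hval (m : ℕ) : ∑' n : ℕ, ces (-a) n * ces s (n + m) =
      sin (π * s) * (Gamma (1 - s + a) * Gamma (s + m) / (π * Gamma ((m : ℝ) + a + 1))) := by
    rw [(hsum m).tsum_eq]
    ring
  have hpos (m : ℕ) :
      0 < Gamma (1 - s + a) * Gamma (s + m) / (π * Gamma ((m : ℝ) + a + 1)) := by
    have h1 := Gamma_pos_of_pos (show 0 < 1 - s + a by linarith)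
    have h2 := Gamma_pos_of_pos (show 0 < s + m by positivity)
    have h3 := Gamma_pos_of_pos (show 0 < (m : ℝ) + a + 1 by positivity)
    positivity
  refine ⟨hsum, ?_, ?_⟩
  · simp only [hval, mul_nonneg_iff_of_pos_right (hpos _), forall_const, sin_pi_mul_nonneg_iff hs]
  · simp only [hval, mul_eq_zero, (hpos _).ne', or_false, forall_const, sin_pi_mul_eq_zero_iff hs]
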